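/- arXiv:1107.3341 — 3 statements merged into one kernel-verified Lean document; each statement's English description precedes it below -/
import Mathlib

section
/- Let q be a prime power, ε = ±1, n ≥ 2, and let p be a prime divisor of gcd(n, q−ε). Define the integer a by: a = ⌊log_p n⌋ + 1 + log_p( ((q−ε)/gcd(n, q−ε))_p ) if p > 2, and a = ⌊log_2 n⌋ + log_2( ((q^2−1)/gcd(n, q−ε))_2 ) if p = 2. Then the map (x, y) ↦ x^{p^a} y^{p^a} from SL^ε_n(q) × SL^ε_n(q) to SL^ε_n(q) is not surjective. -/
/-- The defining condition of the unitary group: `(M^(q))ᵀ * M = 1`, where `M^(q)` raises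
every entry of `M` to the `q`-th power. -/
def UnitaryMat {n : ℕ} {K : Type*} [Field K] (q : ℕ) (M : Matrix (Fin n) (Fin n) K) : Prop :=
  (M.map (· ^ q)).transpose * M = 1

/-- The special unitary group `SU_n(q)`, realized as the set of elements of
`SL_n(K)` (where `K` is the field with `q^2` elements) satisfying the unitarity condition. -/
def suSet (n q : ℕ) (K : Type*) [Field K] : Set (Matrix.SpecialLinearGroup (Fin n) K) :=
  {g | UnitaryMat q (g : Matrix (Fin n) (Fin n) K)}

open Polynomial in
theorem Matrix.exists_isPrimitiveRoot_mem_spectrum {L ι : Type*} [Field L] [IsAlgClosed L]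
    [Fintype ι] [DecidableEq ι] {p k : ℕ} (hp : p.Prime) (hpL : (p : L) ≠ 0) (W : Matrix ι ι L)
    (h1 : W ^ p ^ (k + 1) = 1) (h2 : W ^ p ^ k ≠ 1) :
    ∃ μ ∈ spectrum L W, IsPrimitiveRoot μ (p ^ (k + 1)) := by
  have : Fact p.Prime := ⟨hp⟩
  have : NeZero ((p ^ (k + 1) : ℕ) : L) := ⟨by push_cast; exact pow_ne_zero _ hpL⟩
  have hnot : ¬ IsUnit (aeval W (cyclotomic (p ^ (k + 1)) L)) := by
    intro hu
    have h := congrArg (aeval W) (cyclotomic_prime_pow_mul_X_pow_sub_one L p k)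
    simp only [map_mul, map_sub, map_pow, aeval_X, map_one, h1, sub_self] at h
    exact h2 (sub_eq_zero.1 (hu.mul_right_eq_zero.1 h))
  have h0 : (0 : L) ∈ spectrum L (aeval W (cyclotomic (p ^ (k + 1)) L)) := by
    rwa [spectrum.zero_mem_iff]
  rw [spectrum.map_polynomial_aeval_of_degree_pos _ _
    (degree_cyclotomic_pos _ _ (pow_pos hp.pos _))] at h0
  obtain ⟨μ, hμ, h⟩ := h0
  exact ⟨μ, hμ, isRoot_cyclotomic_iff.1 h⟩

theorem Matrix.exists_dvd_zpow_sub_one {L : Type*} [Field L] {n N : ℕ}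
    (W : Matrix (Fin n) (Fin n) L) (E : ℤ) (hE : IsCoprime E N)
    (hW : ∀ x ∈ spectrum L W, x ^ E ∈ spectrum L W) {μ : L} (hN : N ≠ 0)
    (hμ : IsPrimitiveRoot μ N) (hμW : μ ∈ spectrum L W) :
    ∃ d, 0 < d ∧ d ≤ n ∧ (N : ℤ) ∣ E ^ d - 1 := by
  classical
  have hmem : ∀ i : ℕ, μ ^ (E ^ i) ∈ W.charpoly.roots.toFinset := by
    intro i
    rw [Multiset.mem_toFinset, Polynomial.mem_roots (Matrix.charpoly_monic W).ne_zero,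
      ← Matrix.mem_spectrum_iff_isRoot_charpoly]
    induction i with
    | zero => simpa using hμW
    | succ i ih =>
      rw [pow_succ, _root_.zpow_mul]
      exact hW _ ih
  have hcard : W.charpoly.roots.toFinset.card < (Finset.range (n + 1)).card := by
    have h1 := (Multiset.toFinset_card_le W.charpoly.roots).trans (Polynomial.card_roots' _)
    rw [Matrix.charpoly_natDegree_eq_dim, Fintype.card_fin] at h1
    rw [Finset.card_range]
    lia
  obtain ⟨i, hi, j, hj, hij, heq⟩ :=
    Finset.exists_ne_map_eq_of_card_lt_of_maps_to hcard (fun i _ => hmem i)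
  wlog hlt : i < j generalizing i j
  · exact this j hj i hi hij.symm heq.symm (lt_of_le_of_ne (not_lt.1 hlt) hij.symm)
  rw [Finset.mem_range] at hj
  refine ⟨j - i, by lia, by lia, ?_⟩
  have h1 : μ ^ (E ^ j - E ^ i) = 1 := by
    have hμ0 : μ ≠ 0 := hμ.ne_zero hN
    rw [zpow_sub₀ hμ0, ← heq, div_self (zpow_ne_zero _ hμ0)]
  have h2 : (N : ℤ) ∣ E ^ j - E ^ i := (hμ.zpow_eq_one_iff_dvd _).1 h1
  have h3 : E ^ j - E ^ i = E ^ i * (E ^ (j - i) - 1) := by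
    rw [mul_sub, ← pow_add, mul_one]
    congr 2
    lia
  rw [h3] at h2
  exact (hE.pow_left (m := i)).symm.dvd_of_dvd_mul_left h2

theorem Int.emultiplicity_natCast_eq_factorization {p N : ℕ} (hp : p.Prime) (hN : N ≠ 0) :
    emultiplicity (p : ℤ) (N : ℤ) = (N.factorization p : ℕ) := by
  have : Fact p.Prime := ⟨hp⟩
  rw [Int.natCast_emultiplicity, ← padicValNat_eq_emultiplicity hN, Nat.factorization_def _ hp]

theorem Nat.emultiplicity_le_log {p d n : ℕ} (hp : p.Prime) (hd : 0 < d) (hdn : d ≤ n) :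
    emultiplicity p d ≤ (Nat.log p n : ℕ) := by
  have : Fact p.Prime := ⟨hp⟩
  rw [← padicValNat_eq_emultiplicity hd.ne']
  exact_mod_cast (padicValNat_le_nat_log d).trans (Nat.log_mono_right hdn)

theorem Int.not_pow_dvd_pow_sub_one_of_odd {p s n d : ℕ} {E : ℤ} (hp : p.Prime) (hp2 : p ≠ 2)
    (hE : (p : ℤ) ∣ E - 1) (hs : emultiplicity (p : ℤ) (E - 1) = s) (hd : 0 < d) (hdn : d ≤ n) :
    ¬ ((p ^ (s + Nat.log p n + 1) : ℕ) : ℤ) ∣ E ^ d - 1 := by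
  intro h
  have hpE : ¬ (p : ℤ) ∣ E := fun h' => (Nat.prime_iff_prime_int.1 hp).not_isUnit
    (isUnit_of_dvd_one (by simpa using dvd_sub h' hE))
  have h1 := Int.emultiplicity_pow_sub_pow hp (hp.odd_of_ne_two hp2) (y := 1) hE hpE d
  rw [one_pow, hs] at h1
  push_cast at h
  have h2 := le_emultiplicity_of_pow_dvd h
  rw [h1] at h2
  have h3 := h2.trans (add_le_add le_rfl (Nat.emultiplicity_le_log hp hd hdn))
  norm_cast at h3
  lia

theorem Int.not_two_pow_dvd_pow_sub_one {s n d : ℕ} {E : ℤ} (hE : 2 ∣ E - 1)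
    (hs : emultiplicity (2 : ℤ) (E ^ 2 - 1) = s) (hn : 2 ≤ n) (hd : 0 < d) (hdn : d ≤ n) :
    ¬ ((2 ^ (s + Nat.log 2 n) : ℕ) : ℤ) ∣ E ^ d - 1 := by
  intro h
  have h2E : ¬ 2 ∣ E := by lia
  have hlog : 0 < Nat.log 2 n := Nat.log_pos one_lt_two hn
  push_cast at h
  have h2 := le_emultiplicity_of_pow_dvd h
  have hfac : E ^ 2 - 1 = (E + 1) * (E - 1) := by ring
  rcases Nat.even_or_odd d with hev | hodd
  · have h1 := Int.two_pow_sub_pow (y := 1) hE h2E hev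
    rw [one_pow, ← emultiplicity_mul Int.prime_two, ← hfac, hs] at h1
    have h4 : emultiplicity (2 : ℤ) (d : ℤ) ≤ (Nat.log 2 n : ℕ) := by
      have := Int.natCast_emultiplicity 2 d
      push_cast at this
      rw [this]
      exact Nat.emultiplicity_le_log Nat.prime_two hd hdn
    have h3 := (add_le_add h2 (le_refl (1 : ℕ∞))).trans
      (h1.le.trans (add_le_add le_rfl h4))
    norm_cast at h3
    lia
  · have h1 := emultiplicity_pow_sub_pow_of_prime Int.prime_two (y := 1) hE h2E (n := d)
      (by have := hodd.not_two_dvd_nat; lia)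
    rw [one_pow] at h1
    rw [h1] at h2
    have h3 := h2.trans (emultiplicity_le_emultiplicity_of_dvd_right
      (hfac ▸ dvd_mul_left (E - 1) (E + 1)))
    rw [hs] at h3
    norm_cast at h3
    lia

theorem exists_coprime_pow_eq_one_of_not_dvd_orderOf {G : Type*} [Group G] [Finite G] {p k : ℕ}
    (hp : p.Prime) {x : G} (hx : ¬ p ^ (k + 1) ∣ orderOf x) :
    ∃ M : ℕ, p.Coprime M ∧ x ^ (p ^ k * M) = 1 := by
  obtain ⟨e, M, hM, he⟩ :=
    Nat.exists_eq_pow_mul_and_not_dvd (orderOf_pos x).ne' p hp.ne_one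
  refine ⟨M, (Nat.Prime.coprime_iff_not_dvd hp).2 hM, ?_⟩
  have hek : e ≤ k := by
    by_contra! hlt
    exact hx (he ▸ (pow_dvd_pow p hlt).mul_right M)
  rw [← orderOf_dvd_iff_pow_eq_one, he]
  exact mul_dvd_mul_right (pow_dvd_pow p hek) M

theorem pow_mul_pow_ne_of_orderOf {G : Type*} [Group G] [Finite G] {p a m : ℕ} (hp : p.Prime)
    (hm : 0 < m) {x y z : G} (hz : z ∈ Subgroup.center G) (hzo : orderOf z = p ^ m)
    (hx : ¬ p ^ (a + m) ∣ orderOf x) (hy : ¬ p ^ (a + m) ∣ orderOf y) :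
    z ≠ x ^ p ^ a * y ^ p ^ a := by
  obtain ⟨m, rfl⟩ : ∃ k, m = k + 1 := ⟨m - 1, by lia⟩
  intro h
  obtain ⟨M, hM, hxM⟩ := exists_coprime_pow_eq_one_of_not_dvd_orderOf (k := a + m) hp hx
  obtain ⟨N, hN, hyN⟩ := exists_coprime_pow_eq_one_of_not_dvd_orderOf (k := a + m) hp hy
  have hcomm : Commute (x ^ p ^ a) (y ^ p ^ a) := by
    have hzy : Commute z (y ^ p ^ a) := ((Subgroup.mem_center_iff.1 hz) _).symm
    have hxe : x ^ p ^ a = z * (y ^ p ^ a)⁻¹ := by rw [h]; group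
    rw [hxe]
    exact hzy.mul_left (Commute.refl _).inv_left
  have h1 : z ^ (p ^ m * (M * N)) = 1 := by
    rw [h, hcomm.mul_pow, ← pow_mul, ← pow_mul]
    have e1 : p ^ a * (p ^ m * (M * N)) = (p ^ (a + m) * M) * N := by ring
    have e2 : p ^ a * (p ^ m * (M * N)) = (p ^ (a + m) * N) * M := by ring
    nth_rewrite 1 [e1]
    rw [e2, pow_mul, hxM, pow_mul, hyN, one_pow, one_pow, one_mul]
  rw [← orderOf_dvd_iff_pow_eq_one, hzo, pow_succ] at h1
  have h2 : p ∣ M * N := Nat.dvd_of_mul_dvd_mul_left (pow_pos hp.pos m) h1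
  exact (Nat.Prime.coprime_iff_not_dvd hp).1 (hM.mul_right hN) h2

theorem Matrix.SpecialLinearGroup.not_pow_dvd_orderOf {F L : Type*} [Field F] [Finite F] [Field L]
    [IsAlgClosed L] [Algebra F L] {n p A : ℕ} (hp : p.Prime) (hpF : (p : F) ≠ 0) (hA : 0 < A)
    {E : ℤ} (hE : ¬ (p : ℤ) ∣ E)
    (hEd : ∀ d, 0 < d → d ≤ n → ¬ ((p ^ A : ℕ) : ℤ) ∣ E ^ d - 1)
    {S : Submonoid (SpecialLinearGroup (Fin n) F)}
    (hS : ∀ M ∈ S, ∀ x ∈ spectrum L (M.1.map (algebraMap F L)),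
      x ^ E ∈ spectrum L (M.1.map (algebraMap F L)))
    {M : SpecialLinearGroup (Fin n) F} (hM : M ∈ S) : ¬ p ^ A ∣ orderOf M := by
  intro hdvd
  obtain ⟨k, rfl⟩ : ∃ k, A = k + 1 := ⟨A - 1, by lia⟩
  set w := M ^ (orderOf M / p ^ (k + 1)) with hw
  have hwS : w ∈ S := S.pow_mem hM _
  have hwo : orderOf w = p ^ (k + 1) := orderOf_pow_orderOf_div (orderOf_pos M).ne' hdvd
  have hinj : Function.Injective (fun B : SpecialLinearGroup (Fin n) F =>
      B.1.map (algebraMap F L)) := fun B C h => Subtype.ext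
    (Matrix.map_injective (algebraMap F L).injective h)
  have hpow : ∀ j : ℕ, (w.1.map (algebraMap F L)) ^ j = (w ^ j).1.map (algebraMap F L) := by
    intro j
    rw [← Matrix.map_pow]
    rfl
  have hone : (1 : SpecialLinearGroup (Fin n) F).1.map (algebraMap F L) = 1 := by
    simp
  obtain ⟨μ, hμW, hμ⟩ := Matrix.exists_isPrimitiveRoot_mem_spectrum (k := k) hp
    (L := L) (by rw [← map_natCast (algebraMap F L)]; exact (map_ne_zero _).2 hpF)
    (w.1.map (algebraMap F L))
    (by rw [hpow, ← hwo, pow_orderOf_eq_one, hone])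
    (by
      rw [hpow, ← hone]
      intro h
      have h1 := orderOf_dvd_of_pow_eq_one (hinj h)
      rw [hwo] at h1
      have := (Nat.pow_dvd_pow_iff_le_right hp.one_lt).1 h1
      lia)
  obtain ⟨d, hd, hdn, h⟩ := Matrix.exists_dvd_zpow_sub_one (N := p ^ (k + 1)) _ E
    (by
      push_cast
      exact (((Nat.prime_iff_prime_int.1 hp).coprime_iff_not_dvd.2 hE).symm).pow_right)
    (hS w hwS) (pow_pos hp.pos _).ne' hμ hμW
  exact hEd d hd hdn h

theorem IsPrimitiveRoot.exists_orderOf_eq_mem_center {F : Type*} [Field F] {n N : ℕ} (hn : 0 < n)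
    {ζ : F} (hζ : IsPrimitiveRoot ζ N) (hN : N ∣ n) :
    ∃ z ∈ Subgroup.center (Matrix.SpecialLinearGroup (Fin n) F), orderOf z = N ∧
      z.1 = Matrix.scalar (Fin n) ζ := by
  have : NeZero n := ⟨hn.ne'⟩
  have hdet : (Matrix.scalar (Fin n) ζ).det = 1 := by
    simp [(hζ.pow_eq_one_iff_dvd n).2 hN]
  obtain ⟨z, hz⟩ : ∃ z : Matrix.SpecialLinearGroup (Fin n) F, z.1 = Matrix.scalar (Fin n) ζ :=
    ⟨⟨_, hdet⟩, rfl⟩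
  refine ⟨z, ?_, ?_, hz⟩
  · rw [Subgroup.mem_center_iff]
    intro g
    apply Subtype.ext
    change g.1 * z.1 = z.1 * g.1
    rw [hz]
    exact ((Matrix.scalar_commute ζ (fun _ => Commute.all _ _) g.1).eq).symm
  · rw [hζ.eq_orderOf]
    apply orderOf_eq_orderOf_iff.2
    intro j
    rw [← Matrix.scalar_inj (n := Fin n) (r := ζ ^ j), map_pow, ← hz, map_one,
      ← Matrix.SpecialLinearGroup.coe_pow, ← Matrix.SpecialLinearGroup.coe_one]
    exact Subtype.val_injective.eq_iff.symm

theorem exists_isPrimitiveRoot_of_dvd_card_sub_one {F : Type*} [Field F] [Fintype F] {N : ℕ}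
    (hN : N ∣ Fintype.card F - 1) : ∃ ζ : F, IsPrimitiveRoot ζ N := by
  obtain ⟨g, hg⟩ := IsCyclic.exists_ofOrder_eq_natCard (α := Fˣ)
  rw [Nat.card_units, Nat.card_eq_fintype_card] at hg
  have h0 : N ≠ 0 := by
    rintro rfl
    have := Fintype.one_lt_card (α := F)
    have := Nat.eq_zero_of_zero_dvd hN
    lia
  refine ⟨((g ^ (orderOf g / N) : Fˣ) : F), ?_⟩
  rw [IsPrimitiveRoot.coe_units_iff]
  have := IsPrimitiveRoot.orderOf (g ^ (orderOf g / N))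
  rwa [orderOf_pow_orderOf_div (orderOf_pos g).ne' (hg ▸ hN)] at this

/-- The common argument for both groups, in terms of `E = ε q` and `N = q - ε`. -/
theorem not_forall_exists_pow_mul_pow {F : Type*} [Field F] [Fintype F] {q n p a N : ℕ} {E : ℤ}
    (hq : 2 ≤ q) (hn : 2 ≤ n) (hp : p.Prime) (hpF : (p : F) ≠ 0) (hEN : (E - 1).natAbs = N)
    (hE2 : E ^ 2 = q ^ 2) (hNF : N ∣ Fintype.card F - 1) (hpN : p ∣ Nat.gcd n N)
    (ha : a = (if p = 2 then Nat.log 2 n + ((q ^ 2 - 1) / Nat.gcd n N).factorization 2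
        else Nat.log p n + 1 + (N / Nat.gcd n N).factorization p))
    (S : Submonoid (Matrix.SpecialLinearGroup (Fin n) F))
    (hS : ∀ M ∈ S,
      ∀ x ∈ spectrum (AlgebraicClosure F) (M.1.map (algebraMap F (AlgebraicClosure F))),
      x ^ E ∈ spectrum (AlgebraicClosure F) (M.1.map (algebraMap F (AlgebraicClosure F))))
    (hSz : ∀ ζ : F, ζ ^ N = 1 → ∀ z : Matrix.SpecialLinearGroup (Fin n) F,
      z.1 = Matrix.scalar (Fin n) ζ → z ∈ S) :
    ¬ ∀ g ∈ S, ∃ x ∈ S, ∃ y ∈ S, g = x ^ p ^ a * y ^ p ^ a := by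
  intro hsurj
  have hq1 : 0 < q ^ 2 - 1 := by
    have := Nat.pow_le_pow_left hq 2
    lia
  have hE2' : E ^ 2 - 1 = ((q ^ 2 - 1 : ℕ) : ℤ) := by
    rw [Nat.cast_sub (by lia), hE2]
    push_cast
    ring
  have hNq : N ∣ q ^ 2 - 1 := by
    rw [← Int.natCast_dvd_natCast, ← hE2', ← hEN, Int.natAbs_dvd]
    exact ⟨E + 1, by ring⟩
  have hN0 : N ≠ 0 := fun h => by
    rw [h] at hNq
    exact hq1.ne' (Nat.eq_zero_of_zero_dvd hNq)
  set g := Nat.gcd n N with hg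
  have hg0 : g ≠ 0 := Nat.gcd_ne_zero_right hN0
  have hgN : g ∣ N := Nat.gcd_dvd_right n N
  set m := g.factorization p with hm
  have hm0 : 0 < m := hp.factorization_pos_of_dvd hg0 hpN
  have hmg : p ^ m ∣ g := Nat.ordProj_dvd g p
  have hpE1 : (p : ℤ) ∣ E - 1 := by
    rw [← Int.dvd_natAbs, hEN]
    exact_mod_cast hpN.trans hgN
  have hpE : ¬ (p : ℤ) ∣ E := fun h' => (Nat.prime_iff_prime_int.1 hp).not_isUnit
    (isUnit_of_dvd_one (by simpa using dvd_sub h' hpE1))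
  have hEd : ∀ d, 0 < d → d ≤ n → ¬ ((p ^ (a + m) : ℕ) : ℤ) ∣ E ^ d - 1 := by
    intro d hd hdn
    split_ifs at ha with hp2
    · have hv : (q ^ 2 - 1).factorization 2 = ((q ^ 2 - 1) / g).factorization 2 + m := by
        rw [Nat.factorization_div (hgN.trans hNq), Finsupp.tsub_apply, hm, hp2]
        have := (Nat.factorization_le_iff_dvd hg0 hq1.ne').2 (hgN.trans hNq) 2
        lia
      have he : a + m = (q ^ 2 - 1).factorization 2 + Nat.log 2 n := by lia
      rw [he, hp2]
      refine Int.not_two_pow_dvd_pow_sub_one (by simpa [hp2] using hpE1) ?_ hn hd hdn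
      rw [hE2']
      exact Int.emultiplicity_natCast_eq_factorization Nat.prime_two hq1.ne'
    · have hv : N.factorization p = (N / g).factorization p + m := by
        rw [Nat.factorization_div hgN, Finsupp.tsub_apply, hm]
        have := (Nat.factorization_le_iff_dvd hg0 hN0).2 hgN p
        lia
      have he : a + m = N.factorization p + Nat.log p n + 1 := by lia
      rw [he]
      refine Int.not_pow_dvd_pow_sub_one_of_odd hp hp2 hpE1 ?_ hd hdn
      rw [← Int.emultiplicity_natCast_eq_factorization hp hN0, ← hEN,
        Int.natCast_emultiplicity, Int.emultiplicity_natAbs]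
  obtain ⟨ζ, hζ⟩ := exists_isPrimitiveRoot_of_dvd_card_sub_one ((hmg.trans hgN).trans hNF)
  obtain ⟨z, hzc, hzo, hz⟩ := hζ.exists_orderOf_eq_mem_center (n := n) (by lia)
    (hmg.trans (Nat.gcd_dvd_left n N))
  obtain ⟨x, hx, y, hy, hxy⟩ := hsurj z
    (hSz ζ ((hζ.pow_eq_one_iff_dvd N).2 (hmg.trans hgN)) z hz)
  exact pow_mul_pow_ne_of_orderOf hp hm0 hzc hzo
    (Matrix.SpecialLinearGroup.not_pow_dvd_orderOf hp hpF (by lia) hpE hEd hS hx)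
    (Matrix.SpecialLinearGroup.not_pow_dvd_orderOf hp hpF (by lia) hpE hEd hS hy) hxy

theorem Matrix.map_mem_spectrum_map {L ι : Type*} [Field L] [Fintype ι] [DecidableEq ι]
    (f : L →+* L) {W : Matrix ι ι L} {x : L} (hx : x ∈ spectrum L W) :
    f x ∈ spectrum L (W.map f) := by
  rw [Matrix.mem_spectrum_iff_isRoot_charpoly] at hx ⊢
  rw [Matrix.charpoly_map]
  exact hx.map

theorem Matrix.zpow_neg_mem_spectrum {L ι : Type*} [Field L] [Fintype ι] [DecidableEq ι]
    (f : L →+* L) {q : ℕ} (hf : ∀ x, f x = x ^ q) {W : Matrix ι ι L}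
    (hW : (W.map f).transpose * W = 1) {x : L} (hx : x ∈ spectrum L W) :
    x ^ (-(q : ℤ)) ∈ spectrum L W := by
  have h1 : f x ∈ spectrum L (W.map f).transpose := by
    rw [Matrix.mem_spectrum_iff_isRoot_charpoly, Matrix.charpoly_transpose,
      ← Matrix.mem_spectrum_iff_isRoot_charpoly]
    exact Matrix.map_mem_spectrum_map f hx
  let U : (Matrix ι ι L)ˣ := ⟨W, (W.map f).transpose, mul_eq_one_comm.1 hW, hW⟩
  have hfx : f x ≠ 0 := by
    intro h
    rw [h, spectrum.zero_mem_iff] at h1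
    exact h1 U⁻¹.isUnit
  have h2 : ((Units.mk0 (f x) hfx)⁻¹ : Lˣ).1 ∈ spectrum L ((U⁻¹)⁻¹ : (Matrix ι ι L)ˣ).1 :=
    spectrum.inv_mem_iff.1 h1
  simpa [hf, U] using h2

/-- The special unitary group as a submonoid, for a ring endomorphism `f` in the role of
`x ↦ x ^ q`. -/
def suSubmonoid {n q : ℕ} {K : Type*} [Field K] (f : K →+* K) (hf : ∀ x, f x = x ^ q) :
    Submonoid (Matrix.SpecialLinearGroup (Fin n) K) where
  carrier := suSet n q K
  one_mem' := by
    have h : (fun x : K => x ^ q) = f := funext fun x => (hf x).symm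
    change (Matrix.map (1 : Matrix (Fin n) (Fin n) K) (fun x => x ^ q)).transpose * 1 = 1
    rw [h]
    simp
  mul_mem' := by
    intro A B hA hB
    have h : (fun x : K => x ^ q) = f := funext fun x => (hf x).symm
    change (Matrix.map A.1 (fun x => x ^ q)).transpose * A.1 = 1 at hA
    change (Matrix.map B.1 (fun x => x ^ q)).transpose * B.1 = 1 at hB
    change (Matrix.map (A.1 * B.1) (fun x => x ^ q)).transpose * (A.1 * B.1) = 1
    rw [h] at hA hB ⊢
    rw [Matrix.map_mul, Matrix.transpose_mul, Matrix.mul_assoc, ← Matrix.mul_assoc _ A.1, hA,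
      Matrix.one_mul, hB]

theorem stmt8 (q n p : ℕ) (hq : IsPrimePow q) (hn : 2 ≤ n) (hp : p.Prime) :
    -- the case ε = +1, i.e. SL_n(q)
    (∀ a : ℕ, p ∣ Nat.gcd n (q - 1) →
      a = (if p = 2 then Nat.log 2 n + ((q ^ 2 - 1) / Nat.gcd n (q - 1)).factorization 2
        else Nat.log p n + 1 + ((q - 1) / Nat.gcd n (q - 1)).factorization p) →
      ∀ (F : Type) [Field F] [Fintype F], Fintype.card F = q →
        ¬ Function.Surjective (fun xy :
            Matrix.SpecialLinearGroup (Fin n) F × Matrix.SpecialLinearGroup (Fin n) F =>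
              xy.1 ^ p ^ a * xy.2 ^ p ^ a)) ∧
    -- the case ε = -1, i.e. SU_n(q) ⊆ SL_n(q^2)
    (∀ a : ℕ, p ∣ Nat.gcd n (q + 1) →
      a = (if p = 2 then Nat.log 2 n + ((q ^ 2 - 1) / Nat.gcd n (q + 1)).factorization 2
        else Nat.log p n + 1 + ((q + 1) / Nat.gcd n (q + 1)).factorization p) →
      ∀ (K : Type) [Field K] [Fintype K], Fintype.card K = q ^ 2 →
        ¬ ∀ g ∈ suSet n q K, ∃ x ∈ suSet n q K, ∃ y ∈ suSet n q K,
          g = x ^ p ^ a * y ^ p ^ a) := by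
  have hq2 : 2 ≤ q := hq.two_le
  obtain ⟨r, f, hr, hf, hrf⟩ := hq
  rw [← Nat.prime_iff] at hr
  have : Fact r.Prime := ⟨hr⟩
  have hchar : ∀ (F : Type) [Field F] [Fintype F] (k : ℕ), Fintype.card F = q ^ k → k ≠ 0 →
      CharP F r := by
    intro F _ _ k hF hk
    rw [← hrf, ← pow_mul] at hF
    obtain ⟨c, hc⟩ := CharP.exists F
    obtain ⟨e, hcp, he⟩ := FiniteField.card F c
    rw [he] at hF
    have h1 : c ∣ r := hcp.dvd_of_dvd_pow (hF ▸ dvd_pow_self c e.pos.ne')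
    rwa [← (Nat.prime_dvd_prime_iff_eq hcp hr).1 h1]
  have hpF : ∀ (F : Type) [Field F] [CharP F r] (N : ℕ), (∀ x, x ∣ q → x ∣ N → x = 1) → p ∣ N →
      (p : F) ≠ 0 := by
    intro F _ _ N hN hpN h0
    rw [CharP.cast_eq_zero_iff F r, Nat.prime_dvd_prime_iff_eq hr hp] at h0
    subst h0
    exact hp.ne_one (hN _ (hrf ▸ dvd_pow_self r hf.ne') hpN)
  constructor
  · intro a hpg ha F _ _ hF hsurj
    have := hchar F 1 (by simpa using hF) one_ne_zero
    have : CharP (AlgebraicClosure F) r :=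
      charP_of_injective_algebraMap (algebraMap F (AlgebraicClosure F)).injective r
    refine not_forall_exists_pow_mul_pow (F := F) (E := q) hq2 hn hp
      (hpF F (q - 1) (fun x hx hx' => ?_) (hpg.trans (Nat.gcd_dvd_right _ _)))
      (by lia) rfl (by rw [hF]) hpg ha ⊤ ?_ (fun _ _ _ _ => Submonoid.mem_top _) ?_
    · have := (Nat.dvd_sub_iff_right (by lia) hx).1 hx'
      exact Nat.dvd_one.1 this
    · intro M _ x hx
      have h := Matrix.map_mem_spectrum_map (iterateFrobenius (AlgebraicClosure F) r f) hx
      have hM : (M.1.map (algebraMap F (AlgebraicClosure F))).map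
          (iterateFrobenius (AlgebraicClosure F) r f) =
          M.1.map (algebraMap F (AlgebraicClosure F)) := by
        ext i j
        simp only [Matrix.map_apply, iterateFrobenius_def, hrf, ← map_pow]
        rw [← hF, FiniteField.pow_card]
      rw [hM, iterateFrobenius_def, hrf] at h
      simpa using h
    · intro g _
      obtain ⟨⟨x, y⟩, h⟩ := hsurj g
      exact ⟨x, Submonoid.mem_top _, y, Submonoid.mem_top _, h.symm⟩
  · intro a hpg ha K _ _ hK
    have := hchar K 2 hK two_ne_zero
    have : CharP (AlgebraicClosure K) r :=
      charP_of_injective_algebraMap (algebraMap K (AlgebraicClosure K)).injective r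
    have hfK : ∀ x : K, iterateFrobenius K r f x = x ^ q := fun x => by
      rw [iterateFrobenius_def, hrf]
    have hfL : ∀ x : AlgebraicClosure K,
        iterateFrobenius (AlgebraicClosure K) r f x = x ^ q := fun x => by
      rw [iterateFrobenius_def, hrf]
    refine not_forall_exists_pow_mul_pow (F := K) (E := -q) hq2 hn hp
      (hpF K (q + 1) (fun x hx hx' => ?_) (hpg.trans (Nat.gcd_dvd_right _ _)))
      (by lia) (by ring) ?_ hpg ha (suSubmonoid (iterateFrobenius K r f) hfK) ?_ ?_
    · exact Nat.dvd_one.1 ((Nat.dvd_add_right hx).1 hx')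
    · rw [hK]
      exact ⟨q - 1, by simpa using Nat.sq_sub_sq q 1⟩
    · intro M hM x hx
      refine Matrix.zpow_neg_mem_spectrum _ hfL ?_ hx
      have h := congrArg (fun B => B.map (algebraMap K (AlgebraicClosure K)))
        (show (M.1.map (· ^ q)).transpose * M.1 = 1 from hM)
      simp only [Matrix.map_mul] at h
      rw [Matrix.map_one _ (map_zero _) (map_one _)] at h
      rw [← h]
      congr 1
      ext i j
      simp [hfL]
    · intro ζ hζ z hz
      change (z.1.map (· ^ q)).transpose * z.1 = 1
      have h : (fun x : K => x ^ q) = iterateFrobenius K r f := funext fun x => (hfK x).symm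
      rw [hz, h]
      ext i j
      by_cases hij : i = j <;>
        simp [hij, Matrix.one_apply, hfK, ← pow_succ, hζ, Matrix.mul_diagonal,
          show q ≠ 0 by lia]
end

section
/- Let k > 2 be an integer. Then there exist finite quasisimple groups G of arbitrarily large order (i.e. for every M there exists such G with |G| > M) such that the map (x, y) ↦ x^k y^k from G × G to G is not surjective. -/
/-- A group is quasisimple if it is perfect and its quotient by its center is a
non-abelian simple group. -/
def IsQuasisimple (G : Type*) [Group G] : Prop :=
  commutator G = ⊤ ∧ IsSimpleGroup (G ⧸ Subgroup.center G) ∧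
    ∃ a b : G ⧸ Subgroup.center G, a * b ≠ b * a

/-- The map `(x, y) ↦ x^k y^k` on `G × G` is not surjective. -/
def PowProdNotSurjective (G : Type*) [Group G] (k : ℕ) : Prop :=
  ¬ Function.Surjective (fun xy : G × G => xy.1 ^ k * xy.2 ^ k)

open Polynomial in
/-- A matrix of determinant one and odd prime size `r`, over a field containing a primitive
`r`-th root of unity but no element of order `r ^ 2`, cannot have order `r ^ 2`. -/
lemma Matrix.pow_eq_one_of_pow_sq_eq_one {K : Type*} [Field K] {r : ℕ} (hr : r.Prime)
    (hodd : Odd r) {ξ : K} (hξ : IsPrimitiveRoot ξ r)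
    (hK : ∀ b : K, b ^ (r * r) = 1 → b ^ r = 1)
    (A : Matrix (Fin r) (Fin r) K) (hdet : A.det = 1) (hA : A ^ (r * r) = 1) : A ^ r = 1 := by
  classical
  by_contra hne
  have key : ∀ ζ ∈ nthRootsFinset r (1 : K), ζ ≠ 1 →
      IsUnit (aeval A (X ^ r - C ζ : K[X])) := by
    intro ζ hζ hζ1
    rw [mem_nthRootsFinset hr.pos] at hζ
    have hirr : Irreducible (X ^ r - C ζ : K[X]) := by
      refine X_pow_sub_C_irreducible_of_prime hr fun b hb ↦ hζ1 ?_
      rw [← hb]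
      exact hK b (by rw [pow_mul, hb, hζ])
    have hnd : ¬ (X ^ r - C ζ : K[X]) ∣ A.charpoly := by
      intro hdvd
      have heq : A.charpoly = X ^ r - C ζ := by
        refine (eq_of_monic_of_dvd_of_natDegree_le (monic_X_pow_sub_C ζ hr.ne_zero)
          A.charpoly_monic hdvd ?_)
        rw [natDegree_X_pow_sub_C, Matrix.charpoly_natDegree_eq_dim, Fintype.card_fin]
      have h := A.det_eq_sign_charpoly_coeff
      rw [heq, hdet, Fintype.card_fin, hodd.neg_one_pow] at h
      simp [coeff_X_pow, hr.ne_zero.symm] at h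
      exact hζ1 h.symm
    obtain ⟨u, v, huv⟩ := (hirr.coprime_iff_not_dvd).2 hnd
    have h := congrArg (aeval A) huv
    rw [map_add, map_mul, map_mul, Matrix.aeval_self_charpoly, mul_zero, add_zero, map_one] at h
    exact IsUnit.of_mul_eq_one_right _ h
  have hprod := congrArg (aeval A) (congrArg (fun q : K[X] ↦ q.comp (X ^ r))
    (X_pow_sub_one_eq_prod hr.pos hξ))
  have h1 : (1 : K) ∈ nthRootsFinset r (1 : K) := by simp [mem_nthRootsFinset hr.pos]
  simp only [sub_comp, pow_comp, X_comp, one_comp, prod_comp, C_comp, ← pow_mul] at hprod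
  rw [← Finset.mul_prod_erase _ _ h1, map_mul] at hprod
  have hunit : IsUnit (aeval A (∏ ζ ∈ (nthRootsFinset r (1 : K)).erase 1, (X ^ r - C ζ))) := by
    refine Finset.prod_induction (fun ζ : K ↦ (X ^ r - C ζ : K[X])) (fun q ↦ IsUnit (aeval A q))
      (fun a b ha hb ↦ by rw [map_mul]; exact ha.mul hb) (by simp) fun ζ hζ ↦ ?_
    exact key ζ (Finset.mem_of_mem_erase hζ) (Finset.ne_of_mem_erase hζ)
  rw [map_sub, map_pow, aeval_X, map_one, hA, sub_self, eq_comm,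
    hunit.mul_left_eq_zero] at hprod
  simp [sub_eq_zero] at hprod
  exact hne hprod

/-- If `2` is not a square in the field `K`, then `SL₂(K)` has no element of order `8`. -/
lemma Matrix.SpecialLinearGroup.pow_four_eq_one_of_pow_eight_eq_one {K : Type*} [Field K]
    (h2 : ¬ IsSquare (2 : K)) (A : Matrix.SpecialLinearGroup (Fin 2) K) (hA : A ^ 8 = 1) :
    A ^ 4 = 1 := by
  have ch : ∀ B : Matrix.SpecialLinearGroup (Fin 2) K,
      (B : Matrix (Fin 2) (Fin 2) K) ^ 2 = B.1.trace • B.1 - 1 := by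
    intro B
    have h := Matrix.aeval_self_charpoly B.1
    rw [Matrix.charpoly_fin_two, B.2] at h
    simp [Algebra.smul_def] at h ⊢
    rw [eq_sub_iff_add_eq, ← sub_eq_zero, ← h]
    abel
  have h20 : (2 : K) ≠ 0 := fun h ↦ h2 ⟨0, by simp [h]⟩
  have hsq : (A ^ 4).1 ^ 2 = 1 := by
    rw [← coe_pow, ← pow_mul, hA, coe_one]
  have hB := ch (A ^ 4)
  have hBdet := (A ^ 4).2
  rw [hsq] at hB
  generalize hM : (A ^ 4).1 = B at hB hBdet
  have e00 := congrFun (congrFun hB 0) 0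
  have e01 := congrFun (congrFun hB 0) 1
  have e10 := congrFun (congrFun hB 1) 0
  have e11 := congrFun (congrFun hB 1) 1
  rw [det_fin_two] at hBdet
  simp [trace_fin_two] at e00 e01 e10 e11
  have ht : B 0 0 + B 1 1 ≠ 0 := fun h ↦ h20 (by linear_combination e00 + B 0 0 * h)
  have h01 : B 0 1 = 0 := e01.resolve_left ht
  have h10 : B 1 0 = 0 := e10.resolve_left ht
  have h11 : B 1 1 = B 0 0 := mul_left_cancel₀ ht (by linear_combination e00 - e11)
  rw [h01, h11, zero_mul, sub_zero, mul_self_eq_one_iff] at hBdet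
  rcases hBdet with h1 | h1
  · refine Subtype.ext ?_
    rw [hM]
    ext i j
    fin_cases i <;> fin_cases j <;> simp [h01, h10, h11, h1]
  · exfalso
    have hB1 : A.1 ^ 4 = -1 := by
      rw [← coe_pow, hM]
      ext i j
      fin_cases i <;> fin_cases j <;> simp [h01, h10, h11, h1]
    have hq : (A.1.trace ^ 2 - 2) • A.1 ^ 2 = 0 := by
      have h3 : A.1 ^ 2 + 1 = A.1.trace • A.1 := by rw [ch A]; abel
      have h4 := congrArg (fun B ↦ B ^ 2) h3
      simp only [smul_pow] at h4
      rw [sub_smul, ← h4, show (A.1 ^ 2 + 1) ^ 2 = A.1 ^ 4 + 2 • A.1 ^ 2 + 1 by noncomm_ring, hB1,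
        two_smul, two_smul]
      abel
    rcases smul_eq_zero.1 hq with h | h
    · exact h2 ⟨A.1.trace, by linear_combination -h⟩
    · have h5 := congrArg det h
      rw [det_pow, A.2] at h5
      simp at h5

/-- A central element of prime order `r` is not a product of two `k`-th powers as soon as
all `s`-th powers have order prime to `r`, for some divisor `s` of `k`. -/
lemma powProdNotSurjective_of_mem_center {G : Type*} [Group G] [Finite G] {r s k : ℕ}
    (hr : r.Prime) (hs : s ∣ k) {z : G} (hz : z ∈ Subgroup.center G) (hzr : orderOf z = r)
    (h : ∀ x : G, x ^ (s * r) = 1 → x ^ s = 1) : PowProdNotSurjective G k := by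
  have hcop : ∀ x : G, ¬ r ∣ orderOf (x ^ k) := by
    intro x hx
    obtain ⟨t, rfl⟩ := hs
    rw [pow_mul] at hx
    obtain ⟨m, hm⟩ := hx.trans (orderOf_pow_dvd t)
    have hpos : 0 < orderOf (x ^ s) := orderOf_pos _
    have hy := h (x ^ m) (by
      rw [← pow_mul, show m * (s * r) = s * (r * m) by ring, ← hm, pow_mul, pow_orderOf_eq_one])
    rw [← pow_mul, mul_comm, pow_mul] at hy
    have hle := Nat.le_of_dvd (Nat.pos_of_ne_zero (by rintro rfl; omega))
      (orderOf_dvd_of_pow_eq_one hy)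
    have := hr.two_le
    nlinarith
  intro hsurj
  obtain ⟨⟨x, y⟩, hxy⟩ := hsurj z
  dsimp only at hxy
  set a := orderOf (x ^ k) with ha
  set b := orderOf (y ^ k) with hb
  have hcomm : Commute (x ^ k) (y ^ k) := by
    have h1 : x ^ k = z * (y ^ k)⁻¹ := eq_mul_inv_of_mul_eq hxy
    rw [h1]
    exact Commute.mul_left (Subgroup.mem_center_iff.1 hz _).symm (Commute.refl _).inv_left
  have hz1 : z ^ (a * b) = 1 := by
    rw [← hxy, hcomm.mul_pow, pow_mul, ha, pow_orderOf_eq_one, one_pow, one_mul, mul_comm, pow_mul,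
      hb, pow_orderOf_eq_one, one_pow]
  rcases hr.dvd_mul.1 (hzr ▸ orderOf_dvd_of_pow_eq_one hz1) with h1 | h1
  · exact hcop x h1
  · exact hcop y h1

namespace Matrix.SpecialLinearGroup

variable {ι F : Type*} [Field F] [DecidableEq ι] [Fintype ι]

/-- Elements of the special linear group agreeing on the standard basis are equal. -/
lemma ext_smul_single {A B : SpecialLinearGroup ι F}
    (h : ∀ k, A • (Pi.single k 1 : ι → F) = B • (Pi.single k 1 : ι → F)) : A = B := by
  ext i j
  simpa [SpecialLinearGroup.smul_def] using congrFun (h j) i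

lemma smul_smul_comm (A : SpecialLinearGroup ι F) (c : F) (v : ι → F) :
    A • c • v = c • A • v := smul_comm A c v

lemma transvection_smul_single_of_ne {i j : ι} (hij : i ≠ j) (b : F) {k : ι} (hk : k ≠ j) :
    transvection hij b • (Pi.single k 1 : ι → F) = Pi.single k 1 := by
  simp [SpecialLinearGroup.smul_def, transvection_coe, -mulVec_single,
    add_mulVec, single_mulVec_eq, hk.symm]

lemma diag2n_smul_single {i j : ι} (hij : i ≠ j) {a : F} (ha : a ≠ 0) (k : ι) :
    diag2n hij a ha • (Pi.single k 1 : ι → F) =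
      (if k = i then a else if k = j then a⁻¹ else 1) • Pi.single k 1 := by
  ext l
  by_cases hl : l = k
  · subst hl
    simp [SpecialLinearGroup.smul_def, diag2n_coe]
  · simp [SpecialLinearGroup.smul_def, diag2n_coe, hl]

lemma diag2n_decompose {i j : ι} (hij : i ≠ j) (a : F) (ha : a ≠ 0) :
    diag2n hij a ha = transvection hij a * transvection hij.symm (-a⁻¹) * transvection hij a *
      transvection hij (-1) * transvection hij.symm 1 * transvection hij (-1) := by
  refine ext_smul_single fun k ↦ ?_
  rw [diag2n_smul_single]
  simp only [mul_smul]
  by_cases hi : k = i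
  · subst hi
    simp [transvection_smul_single_fst, transvection_smul_single_snd, smul_add,
      smul_smul_comm]
    simp [smul_smul, ha]
  by_cases hj : k = j
  · subst hj
    simp [transvection_smul_single_fst, transvection_smul_single_snd, smul_add,
      smul_smul_comm, hi]
    simp [smul_smul, ha]
  · simp [transvection_smul_single_of_ne, hi, hj]

/-- The special linear group over a field is generated by transvections. -/
lemma transvection_induction [Nontrivial ι] (P : SpecialLinearGroup ι F → Prop)
    (htransvec : ∀ (i j : ι) (h : i ≠ j) c, P (transvection h c))
    (hmul : ∀ A B, P A → P B → P (A * B)) (A : SpecialLinearGroup ι F) : P A := by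
  refine diagonal_transvection_induction' P _ (fun i j hij c hc ↦ ?_) htransvec hmul
  rw [diag2n_decompose]
  refine hmul _ _ (hmul _ _ (hmul _ _ (hmul _ _ (hmul _ _ ?_ ?_) ?_) ?_) ?_) ?_
  all_goals exact htransvec _ _ _ _

open scoped commutatorElement in
lemma commutator_transvection_transvection {i j k : ι} (hij : i ≠ j) (hik : i ≠ k) (hkj : k ≠ j)
    (c : F) : ⁅transvection hik c, transvection hkj 1⁆ = transvection hij c := by
  rw [commutatorElement_def, transvection_inv, transvection_inv]
  refine ext_smul_single fun l ↦ ?_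
  simp only [mul_smul]
  by_cases hj : l = j
  · subst hj
    simp [transvection_smul_single_of_ne, transvection_smul_single_snd, smul_add,
      smul_smul_comm, hij, hik, hkj, hkj.symm]
    abel
  by_cases hk : l = k
  · subst hk
    simp [transvection_smul_single_of_ne, transvection_smul_single_snd, smul_add,
      smul_smul_comm, hij, hik, hkj]
  · simp [transvection_smul_single_of_ne, hk, hj]

lemma commutator_eq_top_of_two_lt_card (h : 2 < Fintype.card ι) :
    commutator (SpecialLinearGroup ι F) = ⊤ := by
  have : Nontrivial ι := Fintype.one_lt_card_iff_nontrivial.1 (by omega)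
  refine eq_top_iff.2 fun A _ ↦ transvection_induction _ (fun i j hij c ↦ ?_)
    (fun _ _ ↦ mul_mem) A
  obtain ⟨k, hki, hkj⟩ : ∃ k, k ≠ i ∧ k ≠ j := by
    obtain ⟨k, hk⟩ := Finset.exists_mem_notMem_of_card_lt_card
      (s := {i, j}) (t := (Finset.univ : Finset ι)) ((Finset.card_le_two).trans_lt h)
    exact ⟨k, by simpa using hk⟩
  rw [← commutator_transvection_transvection hij hki.symm hkj c]
  exact Subgroup.commutator_mem_commutator (Subgroup.mem_top _) (Subgroup.mem_top _)

open scoped LinearAlgebra.Projectivization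

lemma transvection_mem_iSup_lineStab {i j : ι} (hij : i ≠ j) (c : F) :
    transvection hij c ∈ ⨆ p : ℙ F (ι → F), lineStab p.submodule := by
  have h := SL2Gen.transvection_mem_lineStab hij c
  rw [← Projectivization.submodule_mk (K := F) _ (Pi.single_ne_zero_iff.2 one_ne_zero)] at h
  exact (le_iSup (fun p : ℙ F (ι → F) ↦ lineStab p.submodule) _) h

/-- The Iwasawa structure on the projective special linear group given by its action on lines. -/
noncomputable def iwasawaStructure [Nontrivial ι] :
    MulAction.IwasawaStructure (ProjectiveSpecialLinearGroup ι F) (ℙ F (ι → F)) where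
  T := PSL.iwasawaT
  is_comm p := by
    have : IsMulCommutative (lineStab (F := F) (ι := ι) p.submodule) := by
      rw [← Projectivization.mk_rep p, Projectivization.submodule_mk]
      exact lineStab_isMulCommutative_of_span p.rep p.rep_nonzero
    exact Subgroup.map_isMulCommutative _ _
  is_conj g p := by
    obtain ⟨g, rfl⟩ := QuotientGroup.mk_surjective g
    rw [Matrix.ProjectiveSpecialLinearGroup.smul_proj_mk]
    change Subgroup.map _ _ = _
    rw [PSL.smul_submodule, lineStab_smul, PSL.iwasawaT_map_conj]
  is_generator := by
    have h : (⨆ p : ℙ F (ι → F), lineStab p.submodule) =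
        (⊤ : Subgroup (SpecialLinearGroup ι F)) :=
      eq_top_iff.2 fun A _ ↦ transvection_induction _
        (fun _ _ hij c ↦ transvection_mem_iSup_lineStab hij c) (fun _ _ ↦ mul_mem) A
    rw [← Subgroup.map_iSup, h]
    exact Subgroup.map_top_of_surjective _ (QuotientGroup.mk'_surjective _)

/-- A perfect special linear group over a field is quasisimple. -/
lemma isQuasisimple [Nontrivial ι] (h : commutator (SpecialLinearGroup ι F) = ⊤) :
    IsQuasisimple (SpecialLinearGroup ι F) := by
  have : Group.IsPerfect (SpecialLinearGroup ι F) := ⟨h⟩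
  have hP : Group.IsPerfect (ProjectiveSpecialLinearGroup ι F) := inferInstance
  refine ⟨h, MulAction.IwasawaStructure.isSimpleGroup hP.commutator_eq_top iwasawaStructure
    inferInstance, ?_⟩
  by_contra! hc
  exact Group.IsPerfect.not_isMulCommutative (ProjectiveSpecialLinearGroup ι F) ⟨⟨hc⟩⟩

lemma card_le_card [Fintype F] [Nontrivial ι] [Fintype (SpecialLinearGroup ι F)] :
    Fintype.card F ≤ Fintype.card (SpecialLinearGroup ι F) := by
  obtain ⟨i, j, hij⟩ := exists_pair_ne ι
  refine Fintype.card_le_of_injective (fun c : F ↦ transvection hij c) fun c d hcd ↦ ?_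
  simpa [transvection_coe, hij] using congrArg (fun A : SpecialLinearGroup ι F ↦ A i j) hcd

/-- A scalar `r × r` matrix given by a primitive `r`-th root of unity is central of order `r`. -/
lemma exists_mem_center_orderOf_eq {r : ℕ} (hr : r.Prime) {ξ : F} (hξ : IsPrimitiveRoot ξ r) :
    ∃ z ∈ Subgroup.center (SpecialLinearGroup (Fin r) F), orderOf z = r := by
  have hdet : (scalar (Fin r) ξ).det = 1 := by simp [hξ.pow_eq_one]
  refine ⟨⟨scalar (Fin r) ξ, hdet⟩,
    mem_center_iff.2 ⟨ξ, by rw [Fintype.card_fin, hξ.pow_eq_one], rfl⟩, ?_⟩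
  have : Fact r.Prime := ⟨hr⟩
  have : NeZero r := ⟨hr.ne_zero⟩
  refine orderOf_eq_prime (Subtype.ext ?_) fun h ↦ hξ.ne_one hr.one_lt ?_
  · refine (coe_pow _ r).trans ?_
    rw [← map_pow, hξ.pow_eq_one, map_one, coe_one]
  · simpa using congrArg (fun A : SpecialLinearGroup (Fin r) F ↦ A 0 0) h

end Matrix.SpecialLinearGroup
/-- If `p ≡ 1 + r` modulo `r ^ 2`, then `ZMod p` has no element of multiplicative order `r ^ 2`. -/
lemma ZMod.pow_eq_one_of_pow_mul_self_eq_one {r p : ℕ} (hr : r.Prime)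
    [Fact p.Prime] (hp : p ≡ 1 + r [MOD r * r]) (b : ZMod p) (hb : b ^ (r * r) = 1) : b ^ r = 1 := by
  have : Fact r.Prime := ⟨hr⟩
  by_contra hne
  have hord : orderOf b = r ^ 2 := orderOf_eq_prime_pow (n := 1) (by simpa using hne)
    (by rw [← hb]; ring_nf)
  have hb0 : b ≠ 0 := by
    rintro rfl
    simp [hr.ne_zero] at hb
  have hdvd := orderOf_dvd_of_pow_eq_one (ZMod.pow_card_sub_one_eq_one hb0)
  rw [hord, sq, ← Nat.modEq_iff_dvd' (Fact.out : p.Prime).one_le] at hdvd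
  have h := (Nat.modEq_iff_dvd' (by omega)).1 (hdvd.trans hp)
  rw [Nat.add_sub_cancel_left] at h
  have := Nat.le_of_dvd hr.pos h
  have := hr.two_le
  nlinarith

lemma ZMod.exists_isPrimitiveRoot {r p : ℕ} (hr : r.Prime) [Fact p.Prime] (h : r ∣ p - 1) :
    ∃ ξ : ZMod p, IsPrimitiveRoot ξ r := by
  have : Fact r.Prime := ⟨hr⟩
  obtain ⟨u, hu⟩ := exists_prime_orderOf_dvd_card (G := (ZMod p)ˣ) r (by rwa [ZMod.card_units])
  exact ⟨u, by rw [← hu, ← orderOf_units]; exact IsPrimitiveRoot.orderOf _⟩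

open Matrix in
theorem stmt11 (k : ℕ) (hk : 2 < k) :
    ∀ M : ℕ, ∃ (G : Type) (instG : Group G) (instF : Fintype G),
      @IsQuasisimple G instG ∧ M < @Fintype.card G instF ∧
        @PowProdNotSurjective G instG k := by
  intro M
  rcases Nat.four_dvd_or_exists_odd_prime_and_dvd_of_two_lt hk with h4 | ⟨r, hr, hrk, hodd⟩
  · obtain ⟨p, hpM, hp, hmod⟩ := Nat.forall_exists_prime_gt_and_modEq (max M 3) (q := 8) (a := 3)
      (by norm_num) (by norm_num)
    have : Fact p.Prime := ⟨hp⟩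
    rw [gt_iff_lt, max_lt_iff] at hpM
    have hp8 : p % 8 = 3 := hmod
    have hξ : IsPrimitiveRoot (-1 : ZMod p) 2 := IsPrimitiveRoot.neg_one p (by omega)
    obtain ⟨z, hz, hz2⟩ := SpecialLinearGroup.exists_mem_center_orderOf_eq Nat.prime_two hξ
    refine ⟨SpecialLinearGroup (Fin 2) (ZMod p), inferInstance, inferInstance,
      SpecialLinearGroup.isQuasisimple (SL2.commutator_eq_top (a := 2) ?_ ?_), ?_,
      powProdNotSurjective_of_mem_center Nat.prime_two h4 hz hz2
        (SpecialLinearGroup.pow_four_eq_one_of_pow_eight_eq_one ?_)⟩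
    · intro h
      have := Nat.le_of_dvd (by norm_num) ((ZMod.natCast_eq_zero_iff 2 p).1 (by exact_mod_cast h))
      omega
    · intro h
      have := Nat.le_of_dvd (by norm_num) ((ZMod.natCast_eq_zero_iff 3 p).1
        (by push_cast; linear_combination h))
      omega
    · exact hpM.1.trans_le ((ZMod.card p).symm.le.trans SpecialLinearGroup.card_le_card)
    · rw [ZMod.exists_sq_eq_two_iff (by omega)]
      omega
  · have hr3 : 2 < r := hr.two_le.lt_of_ne' (by rintro rfl; exact absurd hodd (by decide))
    obtain ⟨p, hpM, hp, hmod⟩ := Nat.forall_exists_prime_gt_and_modEq M (q := r * r) (a := 1 + r)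
      (by positivity) (by simp [Nat.coprime_mul_iff_right])
    have : Fact p.Prime := ⟨hp⟩
    have hdvd : r ∣ p - 1 := by
      have h1 : p ≡ 1 [MOD r] := (hmod.of_mul_right r).trans (by simp [Nat.ModEq])
      exact (Nat.modEq_iff_dvd' hp.one_le).1 h1.symm
    obtain ⟨ξ, hξ⟩ := ZMod.exists_isPrimitiveRoot hr hdvd
    obtain ⟨z, hz, hzr⟩ := SpecialLinearGroup.exists_mem_center_orderOf_eq hr hξ
    have : Nontrivial (Fin r) := Fin.nontrivial_iff_two_le.2 hr.two_le
    refine ⟨SpecialLinearGroup (Fin r) (ZMod p), inferInstance, inferInstance,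
      SpecialLinearGroup.isQuasisimple
        (SpecialLinearGroup.commutator_eq_top_of_two_lt_card (by simpa using hr3)), ?_,
      powProdNotSurjective_of_mem_center hr hrk hz hzr fun A hA ↦ Subtype.ext ?_⟩
    · exact hpM.trans_le ((ZMod.card p).symm.le.trans SpecialLinearGroup.card_le_card)
    · refine (Matrix.SpecialLinearGroup.coe_pow A r).trans ?_
      refine Matrix.pow_eq_one_of_pow_sq_eq_one hr hodd hξ (ZMod.pow_eq_one_of_pow_mul_self_eq_one hr hmod) A.1 A.2 ?_
      rw [← Matrix.SpecialLinearGroup.coe_pow, hA, Matrix.SpecialLinearGroup.coe_one]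
end

section
/- Let p be a prime, let n be a positive integer with n ≡ p (mod p^2), let ε = ±1, and let q be a prime power with q ≡ p + ε (mod p^2) if p > 2, and q ≡ 4 + ε (mod 8) if p = 2. Set a = 2 if p > 2 and a = 3 if p = 2. Then the map (x, y) ↦ x^{p^a} y^{p^a} from SL^ε_n(q) × SL^ε_n(q) to SL^ε_n(q) is not surjective. -/
open Function in
theorem dvd_card_of_perm {X : Type*} [Finite X] {p a k : ℕ} (hp : p.Prime) (σ : Equiv.Perm X)
    (hσ : σ ^ p ^ k = 1) (hfix : ∀ s, (σ ^ p ^ a) s ≠ s) : p ^ (a + 1) ∣ Nat.card X := by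
  classical
  have := Fintype.ofFinite X
  rw [Nat.card_congr (MulAction.selfEquivSigmaOrbits (Subgroup.zpowers σ) X), Nat.card_sigma]
  refine Finset.dvd_sum fun s _ => ?_
  have h1 := MulAction.minimalPeriod_eq_card (a := σ) (b := s.out)
  rw [Nat.card_eq_fintype_card, ← h1]
  have h2 : minimalPeriod (σ • ·) s.out ∣ p ^ k :=
    MulAction.pow_smul_eq_iff_minimalPeriod_dvd.1 (by rw [hσ, one_smul])
  obtain ⟨i, hi, hi'⟩ := (Nat.dvd_prime_pow hp).1 h2
  rw [hi']
  apply pow_dvd_pow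
  by_contra h
  refine hfix s.out (MulAction.pow_smul_eq_iff_minimalPeriod_dvd (a := σ).2 ?_)
  rw [hi']
  exact pow_dvd_pow _ (by omega)

theorem dvd_card_of_perm_on {X : Type*} [Finite X] {p a k : ℕ} (hp : p.Prime) (σ : Equiv.Perm X)
    (hσ : σ ^ p ^ k = 1) (S : Finset X) (hS : ∀ s ∈ S, σ s ∈ S)
    (hfix : ∀ s ∈ S, (σ ^ p ^ a) s ≠ s) : p ^ (a + 1) ∣ S.card := by
  have hS' : ∀ s, σ s ∈ S ↔ s ∈ S := fun s => by
    refine ⟨fun h => ?_, hS s⟩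
    simpa using Equiv.Perm.perm_symm_on_of_perm_on_finset hS h
  have := dvd_card_of_perm (a := a) (k := k) hp (σ.subtypePerm hS')
    (by ext; simp [Equiv.Perm.subtypePerm_pow, hσ])
    (fun s h => hfix s s.2 (by simpa [Equiv.Perm.subtypePerm_pow, Subtype.ext_iff] using h))
  simpa using this

theorem dvd_card_of_eq_mul {X : Type*} [Finite X] {p a : ℕ} (hp : p.Prime)
    (x y z : Equiv.Perm X) (hy : Commute y z)
    (hz : z = x ^ p ^ a * y ^ p ^ a) (S : Finset X) (hxS : ∀ s ∈ S, x s ∈ S)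
    (hyS : ∀ s ∈ S, y s ∈ S) (hfix : ∀ m, ¬ p ∣ m → ∀ s ∈ S, (z ^ m) s ≠ s) :
    p ^ (a + 1) ∣ S.card := by
  classical
  have hpow : ∀ f : Equiv.Perm X, (∀ s ∈ S, f s ∈ S) → ∀ m, ∀ s ∈ S, (f ^ m) s ∈ S := by
    intro f hf m
    induction m with
    | zero => simp
    | succ m ih => intro s hs; rw [pow_succ]; exact ih _ (hf s hs)
  set N := Nat.card (Equiv.Perm X)
  have hN : N ≠ 0 := Nat.card_pos.ne'
  set k := N.factorization p
  set m := N / p ^ k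
  have hm : ¬ p ∣ m := Nat.not_dvd_ordCompl hp hN
  have hkm : ∀ f : Equiv.Perm X, (f ^ m) ^ p ^ k = 1 := fun f => by
    rw [← pow_mul, mul_comm, Nat.ordProj_mul_ordCompl_eq_self, pow_card_eq_one']
  have hxy : x ^ p ^ a = z * (y ^ p ^ a)⁻¹ := by rw [hz]; group
  have hc : Commute (x ^ p ^ a) y := by
    rw [hxy]
    exact hy.symm.mul_left ((Commute.refl y).pow_left _).inv_left
  have hzm : z ^ m = (x ^ m) ^ p ^ a * (y ^ m) ^ p ^ a := by
    rw [hz, (hc.pow_right _).mul_pow]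
    simp only [← pow_mul, mul_comm]
  have hc' : Commute ((x ^ m) ^ p ^ a) (y ^ m) := by
    rw [← pow_mul, mul_comm, pow_mul]
    exact hc.pow_pow _ _
  set u := (x ^ m) ^ p ^ a with hu
  rw [← Finset.card_filter_add_card_filter_not (s := S) (fun s => u s = s)]
  apply dvd_add
  · refine dvd_card_of_perm_on hp (y ^ m) (hkm y) _ ?_ ?_
    · intro s hs
      rw [Finset.mem_filter] at hs ⊢
      refine ⟨hpow y hyS _ _ hs.1, ?_⟩
      rw [← Equiv.Perm.mul_apply, hc'.eq, Equiv.Perm.mul_apply, hs.2]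
    · intro s hs h
      rw [Finset.mem_filter] at hs
      apply hfix m hm s hs.1
      rw [hzm, Equiv.Perm.mul_apply, h, hs.2]
  · refine dvd_card_of_perm_on hp (x ^ m) (hkm x) _ ?_ ?_
    · intro s hs
      rw [Finset.mem_filter] at hs ⊢
      refine ⟨hpow x hxS _ _ hs.1, fun h => hs.2 ?_⟩
      rw [← Equiv.Perm.mul_apply, ((Commute.refl (x ^ m)).pow_left _).eq,
        Equiv.Perm.mul_apply] at h
      exact (x ^ m).injective h
    · intro s hs
      exact (Finset.mem_filter.1 hs).2

theorem dvd_card_of_scalar_eq_mul {F : Type*} [Field F] [Finite F] {n p a : ℕ} (hp : p.Prime)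
    {c : F} (hc : c ^ p = 1) (hc1 : c ≠ 1) {x y z : Matrix.SpecialLinearGroup (Fin n) F}
    (hz : (z : Matrix (Fin n) (Fin n) F) = Matrix.scalar (Fin n) c)
    (hxy : z = x ^ p ^ a * y ^ p ^ a)
    (S : Finset (Fin n → F)) (h0 : 0 ∉ S)
    (hxS : ∀ s ∈ S, (x : Matrix (Fin n) (Fin n) F).mulVec s ∈ S)
    (hyS : ∀ s ∈ S, (y : Matrix (Fin n) (Fin n) F).mulVec s ∈ S) : p ^ (a + 1) ∣ S.card := by
  let φ : Matrix.SpecialLinearGroup (Fin n) F →* Equiv.Perm (Fin n → F) :=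
    (MulAction.toPermHom _ _).comp (Matrix.SpecialLinearGroup.toLin' (n := Fin n) (R := F))
  have hφ : ∀ g v, φ g v = (g : Matrix (Fin n) (Fin n) F).mulVec v := fun g v => rfl
  have hcomm : ∀ g, Commute g z := fun g => by
    apply Subtype.ext
    simp only [Matrix.SpecialLinearGroup.coe_mul, hz]
    exact ((Matrix.scalar_commute c (Commute.all c) _).eq).symm
  refine dvd_card_of_eq_mul hp (φ x) (φ y) (φ z) ((hcomm y).map φ)
    (by rw [hxy]; simp) S (fun s hs => hxS s hs) (fun s hs => hyS s hs) ?_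
  intro m hm s hs h
  rw [← map_pow, hφ, Matrix.SpecialLinearGroup.coe_pow, hz, ← map_pow, Matrix.scalar_apply,
    ← Matrix.smul_one_eq_diagonal, Matrix.smul_mulVec, Matrix.one_mulVec] at h
  have hs0 : s ≠ 0 := fun h => h0 (h ▸ hs)
  obtain ⟨i, hi⟩ := Function.ne_iff.1 hs0
  have h1 : c ^ m = 1 := by
    have := congrFun h i
    exact (mul_eq_right₀ hi).1 this
  have h2 : orderOf c = p := by
    have := Fact.mk hp
    exact orderOf_eq_prime hc hc1
  exact hm (h2 ▸ orderOf_dvd_of_pow_eq_one h1)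

theorem dvd_card_pow_sub_one {F : Type*} [Field F] [Fintype F] {n p a : ℕ} (hp : p.Prime)
    {c : F} (hc : c ^ p = 1) (hc1 : c ≠ 1) {x y z : Matrix.SpecialLinearGroup (Fin n) F}
    (hz : (z : Matrix (Fin n) (Fin n) F) = Matrix.scalar (Fin n) c)
    (hxy : z = x ^ p ^ a * y ^ p ^ a) : p ^ (a + 1) ∣ Fintype.card F ^ n - 1 := by
  classical
  have key : ∀ g : Matrix.SpecialLinearGroup (Fin n) F, ∀ s ∈ ({0}ᶜ : Finset (Fin n → F)),
      (g : Matrix (Fin n) (Fin n) F).mulVec s ∈ ({0}ᶜ : Finset (Fin n → F)) := by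
    intro g s hs
    rw [Finset.mem_compl, Finset.mem_singleton] at hs ⊢
    intro h
    exact hs (Matrix.eq_zero_of_mulVec_eq_zero (by simp) h)
  simpa [Finset.card_compl] using dvd_card_of_scalar_eq_mul hp hc hc1 hz hxy {0}ᶜ (by simp)
    (key x) (key y)

section Hermitian

variable {K : Type*} [Field K] [Fintype K] {q : ℕ}

theorem card_units_of_card_eq_sq (hK : Fintype.card K = q ^ 2) :
    Nat.card Kˣ = (q + 1) * (q - 1) := by
  rw [Nat.card_units, Nat.card_eq_fintype_card, hK]
  simpa using Nat.sq_sub_sq q 1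

theorem exists_pow_add_one_eq (hq : 1 < q) (hK : Fintype.card K = q ^ 2) {c : K} (hc : c ≠ 0)
    (hcq : c ^ q = c) : ∃ s : K, s ≠ 0 ∧ s ^ (q + 1) = c := by
  have hU := card_units_of_card_eq_sq hK
  have hle : (powMonoidHom (q + 1) : Kˣ →* Kˣ).range ≤ (powMonoidHom (q - 1) : Kˣ →* Kˣ).ker := by
    rintro _ ⟨u, rfl⟩
    rw [MonoidHom.mem_ker, powMonoidHom_apply, powMonoidHom_apply, ← pow_mul, ← hU,
      pow_card_eq_one']
  have heq := Subgroup.eq_of_le_of_card_ge hle (by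
    rw [IsCyclic.card_powMonoidHom_ker, IsCyclic.card_powMonoidHom_range, hU,
      Nat.gcd_mul_left_left, Nat.gcd_mul_right_left, Nat.mul_div_cancel_left _ (by omega)])
  have hmem : Units.mk0 c hc ∈ (powMonoidHom (q - 1) : Kˣ →* Kˣ).ker := by
    rw [MonoidHom.mem_ker, powMonoidHom_apply, Units.ext_iff]
    apply mul_right_cancel₀ hc
    simpa [← pow_succ, Nat.sub_add_cancel hq.le] using hcq
  rw [← heq] at hmem
  obtain ⟨u, hu⟩ := hmem
  exact ⟨u, u.ne_zero, by simpa using congrArg Units.val hu⟩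

theorem card_pow_add_one_eq_one [DecidableEq K] (hK : Fintype.card K = q ^ 2) :
    (Finset.univ.filter fun t : K => t ^ (q + 1) = 1).card = q + 1 := by
  have h := IsCyclic.card_powMonoidHom_ker (G := Kˣ) (q + 1)
  rw [card_units_of_card_eq_sq hK, Nat.gcd_mul_right_left] at h
  refine Eq.trans ?_ h
  rw [Nat.card_eq_fintype_card, ← Fintype.card_coe]
  symm
  refine Fintype.card_congr (Equiv.ofBijective
    (fun u => ⟨u.1.1, by
      have hu : u.1 ^ (q + 1) = 1 := u.2
      simpa [Units.ext_iff] using hu⟩) ⟨?_, ?_⟩)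
  · intro u v huv
    exact Subtype.ext (Units.ext (congrArg Subtype.val huv))
  · rintro ⟨t, ht⟩
    have ht' : t ^ (q + 1) = 1 := by simpa using ht
    have ht0 : t ≠ 0 := by
      rintro rfl
      simp at ht'
    exact ⟨⟨Units.mk0 t ht0, by simpa [Units.ext_iff, MonoidHom.mem_ker] using ht'⟩, rfl⟩

/-- The vectors of hermitian norm `c`. -/
noncomputable def hermitianSphere (q n : ℕ) (c : K) : Finset (Fin n → K) :=
  open Classical in Finset.univ.filter fun v => ∑ i, v i ^ (q + 1) = c

theorem mem_hermitianSphere {n : ℕ} {c : K} {v : Fin n → K} :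
    v ∈ hermitianSphere q n c ↔ ∑ i, v i ^ (q + 1) = c := by
  simp [hermitianSphere]

theorem card_hermitianSphere_smul (n : ℕ) (c : K) {s : K} (hs : s ≠ 0) :
    (hermitianSphere q n (s ^ (q + 1) * c)).card = (hermitianSphere q n c).card := by
  symm
  refine Finset.card_bij (fun v _ => s • v) ?_ ?_ ?_
  · intro v hv
    rw [mem_hermitianSphere] at hv ⊢
    simp [mul_pow, ← Finset.mul_sum, hv]
  · intro v _ w _ h
    exact smul_right_injective _ hs h
  · intro w hw
    refine ⟨s⁻¹ • w, ?_, by simp [smul_smul, hs]⟩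
    rw [mem_hermitianSphere] at hw ⊢
    simp [mul_pow, ← Finset.mul_sum, hw, hs]

theorem card_hermitianSphere_succ (n : ℕ) (c : K) :
    (hermitianSphere q (n + 1) c).card
      = ∑ t : K, (hermitianSphere q n (c - t ^ (q + 1))).card := by
  rw [← Finset.card_sigma]
  refine Finset.card_bij' (fun v _ => ⟨v 0, Fin.tail v⟩) (fun w _ => Fin.cons w.1 w.2) ?_ ?_ ?_ ?_
  · intro v hv
    simp only [Finset.mem_sigma, Finset.mem_univ, true_and, mem_hermitianSphere] at hv ⊢
    rw [← hv, Fin.sum_univ_succ]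
    simp [Fin.tail]
  · intro w hw
    simp only [Finset.mem_sigma, Finset.mem_univ, true_and, mem_hermitianSphere] at hw ⊢
    simp [Fin.sum_univ_succ, hw]
  · intro v _
    simp
  · intro w _
    simp

theorem card_hermitianSphere_eq (hq : 1 < q) (hK : Fintype.card K = q ^ 2) (n : ℕ) {c : K}
    (hc : c ≠ 0) (hcq : c ^ q = c) :
    (hermitianSphere q n c).card = (hermitianSphere q n (1 : K)).card := by
  obtain ⟨s, hs, rfl⟩ := exists_pow_add_one_eq hq hK hc hcq
  simpa using card_hermitianSphere_smul (q := q) n 1 hs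

theorem sub_pow_of_card_eq_sq (hq : IsPrimePow q) (hK : Fintype.card K = q ^ 2) (a b : K) :
    (a - b) ^ q = a ^ q - b ^ q := by
  obtain ⟨r, k, hr, hk, rfl⟩ := hq
  have hr' := hr.nat_prime
  obtain ⟨s, hs, m, hs', hm⟩ := FiniteField.card' K
  have hrs : r = s := by
    rw [← Nat.prime_dvd_prime_iff_eq hr' hs']
    apply hr'.dvd_of_dvd_pow (n := m)
    rw [← hm, hK, ← pow_mul]
    exact dvd_pow_self _ (by positivity)
  subst hrs
  have := Fact.mk hr'
  exact sub_pow_char_pow a b k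

theorem mul_card_hermitianSphere_one (hq : IsPrimePow q) (hK : Fintype.card K = q ^ 2) (n : ℕ) :
    (q * (hermitianSphere q n (1 : K)).card : ℤ) = q ^ (2 * n) - (-q) ^ n := by
  classical
  have hq1 := hq.one_lt
  have hnorm : ∀ t : K, (t ^ (q + 1)) ^ q = t ^ (q + 1) := fun t => by
    rw [← pow_mul, show (q + 1) * q = q ^ 2 + q by ring, pow_add, ← hK, FiniteField.pow_card,
      pow_succ']
  have h0 : ∀ n, ((hermitianSphere q (n + 1) (0 : K)).card : ℤ)
      = (hermitianSphere q n (0 : K)).card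
        + (q ^ 2 - 1) * (hermitianSphere q n (1 : K)).card := by
    intro n
    have h1 : ∀ t ∈ (Finset.univ.erase 0 : Finset K),
        ((hermitianSphere q n (0 - t ^ (q + 1))).card : ℤ)
          = (hermitianSphere q n (1 : K)).card := by
      intro t ht
      rw [card_hermitianSphere_eq hq1 hK n]
      · simpa using Finset.ne_of_mem_erase ht
      · rw [sub_pow_of_card_eq_sq hq hK, hnorm, zero_pow (by omega)]
    rw [card_hermitianSphere_succ, Nat.cast_sum, ← Finset.add_sum_erase _ _ (Finset.mem_univ 0),
      Finset.sum_congr rfl h1, Finset.sum_const, Finset.card_erase_of_mem (Finset.mem_univ _),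
      Finset.card_univ, hK, nsmul_eq_mul, Nat.cast_sub (Nat.one_le_pow _ _ (by omega))]
    simp
  have h1 : ∀ n, ((hermitianSphere q (n + 1) (1 : K)).card : ℤ)
      = (q + 1) * (hermitianSphere q n (0 : K)).card
        + (q ^ 2 - (q + 1)) * (hermitianSphere q n (1 : K)).card := by
    intro n
    have h2 : ∀ t : K, ((hermitianSphere q n (1 - t ^ (q + 1))).card : ℤ)
        = if t ^ (q + 1) = 1 then ((hermitianSphere q n (0 : K)).card : ℤ)
          else (hermitianSphere q n (1 : K)).card := by
      intro t
      split_ifs with ht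
      · rw [ht, sub_self]
      · rw [card_hermitianSphere_eq hq1 hK n]
        · exact sub_ne_zero.2 (Ne.symm ht)
        · rw [sub_pow_of_card_eq_sq hq hK, hnorm, one_pow]
    have h3 := Finset.card_filter_add_card_filter_not (s := Finset.univ)
      (fun t : K => t ^ (q + 1) = 1)
    rw [card_pow_add_one_eq_one hK, Finset.card_univ, hK] at h3
    have h4 : ((Finset.univ.filter fun t : K => ¬ t ^ (q + 1) = 1).card : ℤ)
        = q ^ 2 - (q + 1) := by
      zify at h3
      linarith
    rw [card_hermitianSphere_succ, Nat.cast_sum, Finset.sum_congr rfl fun t _ => h2 t,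
      Finset.sum_ite, Finset.sum_const, Finset.sum_const, card_pow_add_one_eq_one hK,
      nsmul_eq_mul, nsmul_eq_mul, h4]
    simp
  have h2 : ∀ n, ((hermitianSphere q n (0 : K)).card - (hermitianSphere q n (1 : K)).card : ℤ)
      = (-q) ^ n := by
    intro n
    induction n with
    | zero => simp [hermitianSphere]
    | succ n ih =>
      rw [h0, h1, pow_succ (-(q : ℤ)), ← ih]
      ring
  induction n with
  | zero => simp [hermitianSphere]
  | succ n ih =>
    have h3 := h2 n
    rw [sub_eq_iff_eq_add] at h3
    rw [h1, h3]
    linear_combination (q ^ 2 : ℤ) * ih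

end Hermitian

theorem UnitaryMat.sum_mulVec_pow {K : Type*} [Field K] {q n : ℕ}
    (hadd : ∀ (v w : Fin n → K), (∑ i, v i * w i) ^ q = ∑ i, v i ^ q * w i ^ q)
    {M : Matrix (Fin n) (Fin n) K} (hM : UnitaryMat q M) (v : Fin n → K) :
    ∑ i, M.mulVec v i ^ (q + 1) = ∑ i, v i ^ (q + 1) := by
  have h1 : ∀ w : Fin n → K, ∑ i, w i ^ (q + 1) = (fun i => w i ^ q) ⬝ᵥ w := fun w => by
    simp [dotProduct, pow_succ]
  have h2 : (fun i => M.mulVec v i ^ q) = (M.map (· ^ q)).mulVec fun i => v i ^ q := by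
    ext i
    exact hadd _ _
  rw [h1, h1, h2, ← Matrix.vecMul_transpose, ← Matrix.dotProduct_mulVec, Matrix.mulVec_mulVec, hM,
    Matrix.one_mulVec]

theorem sum_pow_of_card_eq_sq {K ι : Type*} [Field K] [Fintype K] [Fintype ι] {q : ℕ}
    (hq : IsPrimePow q) (hK : Fintype.card K = q ^ 2) (f : ι → K) :
    (∑ i, f i) ^ q = ∑ i, f i ^ q := by
  have h : ∀ a b : K, (a + b) ^ q = a ^ q + b ^ q := fun a b => by
    have := sub_pow_of_card_eq_sq hq hK (a + b) b
    rw [add_sub_cancel_right] at this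
    rw [this, sub_add_cancel]
  exact map_sum (⟨⟨(· ^ q), zero_pow hq.pos.ne'⟩, h⟩ : K →+ K) f _

theorem not_pow_three_dvd_pow_sub_one {p n Q : ℕ} (hp : p.Prime) (hp2 : p ≠ 2)
    (hn : n ≡ p [MOD p ^ 2]) (hQ : 1 < Q) (h1 : p ∣ Q - 1) (h2 : ¬ p ^ 2 ∣ Q - 1) :
    ¬ p ^ 3 ∣ Q ^ n - 1 := by
  have := Fact.mk hp
  have hn2 : ¬ p ^ 2 ∣ n := by
    rw [hn.dvd_iff dvd_rfl]
    intro h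
    have := Nat.le_of_dvd hp.pos h
    nlinarith [hp.two_le]
  have hn0 : n ≠ 0 := by
    rintro rfl
    exact hn2 (dvd_zero _)
  have hpQ : ¬ p ∣ Q := fun h => hp.one_lt.ne' (Nat.dvd_one.1 (by
    simpa [Nat.sub_sub_self hQ.le] using Nat.dvd_sub h h1))
  have h3 := padicValNat.pow_sub_pow (hp.odd_of_ne_two hp2) hQ h1 hpQ hn0
  have hQn : Q ^ n - 1 ≠ 0 := by
    have := Nat.one_lt_pow hn0 hQ
    omega
  rw [padicValNat_dvd_iff_le (by omega)] at h2
  rw [padicValNat_dvd_iff_le hn0] at hn2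
  rw [padicValNat_dvd_iff_le hQn]
  rw [one_pow] at h3
  omega

theorem pow_mod_sixteen_eq_nine {q n : ℕ} (hq : q % 8 = 3 ∨ q % 8 = 5) (hn : n % 4 = 2) :
    q ^ n % 16 = 9 := by
  obtain ⟨k, rfl⟩ : ∃ k, n = 2 + 4 * k := ⟨n / 4, by omega⟩
  have h1 : q % 16 = 3 ∨ q % 16 = 11 ∨ q % 16 = 5 ∨ q % 16 = 13 := by omega
  have h2 : q ^ 2 % 16 = 9 ∧ q ^ 4 % 16 = 1 := by
    rcases h1 with h | h | h | h <;> simp [Nat.pow_mod, h]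
  rw [pow_add, pow_mul, Nat.mul_mod, Nat.pow_mod (q ^ 4), h2.1, h2.2]
  simp

theorem exists_ne_one_pow_eq_one {F : Type*} [Field F] [Fintype F] {p : ℕ} (hp : p.Prime)
    (h : p ∣ Fintype.card F - 1) : ∃ c : F, c ^ p = 1 ∧ c ≠ 1 := by
  classical
  have := Fact.mk hp
  obtain ⟨u, hu⟩ := exists_prime_orderOf_dvd_card (G := Fˣ) p (by rwa [Fintype.card_units])
  refine ⟨u, ?_, ?_⟩
  · rw [← Units.val_pow_eq_pow_val, ← hu, pow_orderOf_eq_one, Units.val_one]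
  · rw [Ne, Units.val_eq_one]
    rintro rfl
    exact hp.one_lt.ne (by simpa using hu)

/-- The scalar matrix `c` as an element of the special linear group. -/
def scalarSL {F : Type*} [Field F] {n : ℕ} (c : F) (hc : c ^ n = 1) :
    Matrix.SpecialLinearGroup (Fin n) F :=
  ⟨Matrix.scalar (Fin n) c, by simp [hc]⟩

theorem scalarSL_mem_suSet {F : Type*} [Field F] {n q : ℕ} (hq : q ≠ 0) {c : F} (hc : c ^ n = 1)
    (hcq : c ^ (q + 1) = 1) : scalarSL c hc ∈ suSet n q F := by
  change ((Matrix.scalar (Fin n) c).map (· ^ q)).transpose * Matrix.scalar (Fin n) c = 1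
  rw [Matrix.scalar_apply, Matrix.diagonal_map (f := (· ^ q)) (zero_pow hq), Matrix.diagonal_transpose,
    Matrix.diagonal_mul_diagonal]
  simp [← pow_succ, hcq]


theorem stmt13 (p n q : ℕ) (hp : p.Prime) (hn0 : 0 < n) (hq : IsPrimePow q)
    (hn : n ≡ p [MOD p ^ 2]) :
    -- the case ε = +1: q ≡ p + 1 (mod p^2) if p > 2, q ≡ 5 (mod 8) if p = 2
    ((if p = 2 then q ≡ 5 [MOD 8] else q ≡ p + 1 [MOD p ^ 2]) →
      ∀ (F : Type) [Field F] [Fintype F], Fintype.card F = q →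
        ¬ Function.Surjective (fun xy :
            Matrix.SpecialLinearGroup (Fin n) F × Matrix.SpecialLinearGroup (Fin n) F =>
              xy.1 ^ p ^ (if p = 2 then 3 else 2) * xy.2 ^ p ^ (if p = 2 then 3 else 2))) ∧
    -- the case ε = -1: q ≡ p - 1 (mod p^2) if p > 2, q ≡ 3 (mod 8) if p = 2
    ((if p = 2 then q ≡ 3 [MOD 8] else q ≡ p - 1 [MOD p ^ 2]) →
      ∀ (K : Type) [Field K] [Fintype K], Fintype.card K = q ^ 2 →
        ¬ ∀ g ∈ suSet n q K, ∃ x ∈ suSet n q K, ∃ y ∈ suSet n q K,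
          g = x ^ p ^ (if p = 2 then 3 else 2) * y ^ p ^ (if p = 2 then 3 else 2)) := by
  have hpn : p ∣ n := (hn.of_dvd (dvd_pow_self p two_ne_zero)).dvd_iff dvd_rfl |>.2 dvd_rfl
  have hq1 := hq.one_lt
  have hroot : ∀ {F : Type} [Field F] {c : F} {m : ℕ}, c ^ p = 1 → p ∣ m → c ^ m = 1 := by
    rintro F _ c _ hc ⟨k, rfl⟩
    rw [pow_mul, hc, one_pow]
  refine ⟨fun hqp F _ _ hF hsurj => ?_, fun hqp K _ _ hK hsurj => ?_⟩
  · have hpq : p ∣ q - 1 := by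
      split_ifs at hqp with hp2
      · subst hp2
        have : q % 8 = 5 := hqp
        omega
      · exact (Nat.modEq_iff_dvd' hq1.le).1 ((hqp.of_dvd (dvd_pow_self p two_ne_zero)).trans
          (by simp [Nat.ModEq])).symm
    obtain ⟨c, hc, hc1⟩ := exists_ne_one_pow_eq_one (F := F) hp (hF ▸ hpq)
    obtain ⟨⟨x, y⟩, hxy⟩ := hsurj (scalarSL c (hroot hc hpn))
    have hdvd := dvd_card_pow_sub_one hp hc hc1 rfl hxy.symm
    rw [hF] at hdvd
    split_ifs at hqp hdvd with hp2
    · subst hp2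
      have h9 := pow_mod_sixteen_eq_nine (n := n) (Or.inr hqp) hn
      omega
    · refine not_pow_three_dvd_pow_sub_one hp hp2 hn hq1 hpq (fun h => ?_) hdvd
      have h1 : p + 1 ≡ 0 + 1 [MOD p ^ 2] :=
        hqp.symm.trans ((Nat.modEq_iff_dvd' hq1.le).2 h).symm
      have h2 := (Nat.modEq_zero_iff_dvd).1 (Nat.ModEq.add_right_cancel' 1 h1)
      have := Nat.le_of_dvd hp.pos h2
      nlinarith [hp.two_le]
  · have hq0 : q ≠ 0 := by omega
    have hp1 := hp.one_lt
    have hqp' : p ≠ 2 → q + 1 ≡ p [MOD p ^ 2] := fun hp2 => by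
      rw [if_neg hp2] at hqp
      simpa [Nat.sub_add_cancel hp1.le] using hqp.add_right 1
    have hpq : p ∣ q + 1 := by
      by_cases hp2 : p = 2
      · subst hp2
        have : q % 8 = 3 := hqp
        omega
      · exact (((hqp' hp2).of_dvd (dvd_pow_self p two_ne_zero)).dvd_iff dvd_rfl).2 dvd_rfl
    have hfac : q ^ 2 - 1 = (q + 1) * (q - 1) := by simpa using Nat.sq_sub_sq q 1
    have hpQ : p ∣ q ^ 2 - 1 := hfac ▸ hpq.mul_right _
    obtain ⟨c, hc, hc1⟩ := exists_ne_one_pow_eq_one (F := K) hp (hK ▸ hpQ)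
    obtain ⟨x, hx, y, hy, hxy⟩ := hsurj (scalarSL c (hroot hc hpn))
      (scalarSL_mem_suSet hq0 _ (hroot hc hpq))
    by_cases hp2 : p = 2
    · subst hp2
      have hmem : ∀ g ∈ suSet n q K, ∀ s ∈ hermitianSphere q n (1 : K),
          (g : Matrix (Fin n) (Fin n) K).mulVec s ∈ hermitianSphere q n (1 : K) := by
        intro g hg s hs
        rw [mem_hermitianSphere] at hs ⊢
        refine (UnitaryMat.sum_mulVec_pow (fun v w => ?_) hg s).trans hs
        simp_rw [sum_pow_of_card_eq_sq hq hK, mul_pow]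
      have hdvd := dvd_card_of_scalar_eq_mul hp hc hc1 rfl hxy (hermitianSphere q n (1 : K))
        (by simp [mem_hermitianSphere]) (hmem x hx) (hmem y hy)
      have hcard := mul_card_hermitianSphere_one hq hK n
      have h9 := pow_mod_sixteen_eq_nine (n := n) (Or.inl hqp) hn
      obtain ⟨k, hk⟩ := hdvd
      rw [hk, (even_iff_two_dvd.2 hpn).neg_pow] at hcard
      obtain ⟨m, hm⟩ : ∃ m, q ^ n = 16 * m + 9 := ⟨q ^ n / 16, by omega⟩
      have hm' : (q : ℤ) ^ n = 16 * m + 9 := by exact_mod_cast hm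
      rw [mul_comm 2 n, pow_mul, hm'] at hcard
      have h16 : (16 : ℤ) * (q * k - 16 * m ^ 2 - 17 * m) = 72 := by
        push_cast at hcard
        linear_combination hcard
      omega
    · rw [if_neg hp2] at hxy
      have hdvd := dvd_card_pow_sub_one hp hc hc1 rfl hxy
      rw [hK] at hdvd
      refine not_pow_three_dvd_pow_sub_one hp hp2 hn (Nat.one_lt_pow two_ne_zero hq1) hpQ
        (fun h => ?_) hdvd
      rw [hfac] at h
      have hcop : Nat.Coprime (p ^ 2) (q - 1) := by
        apply Nat.Coprime.pow_left
        rw [hp.coprime_iff_not_dvd]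
        intro h'
        have := Nat.dvd_sub hpq h'
        rw [show q + 1 - (q - 1) = 2 by omega] at this
        exact hp2 ((Nat.prime_dvd_prime_iff_eq hp Nat.prime_two).1 this)
      have h2 := ((hqp' hp2).dvd_iff dvd_rfl).1 (hcop.dvd_of_dvd_mul_right h)
      have := Nat.le_of_dvd hp.pos h2
      nlinarith
end
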